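/- Let G be a connected simple undirected graph whose vertex set is partitioned into (V1, V2) such that both induced subgraphs G[V1] and G[V2] are forests and every vertex of V1 has degree exactly 3 in G. Then f_{V1}(G) = β(G) − μ(G), where f_{V1}(G) is the minimum size of a V1-FVS of G, β(G) = |E(G)| − |V(G)| + 1 is the Betti number, and μ(G) is the V1-adjacency matching number of G. -/

import Mathlib

/-- A feedback vertex set of `G` is a set `F` of vertices whose deletion leaves
an acyclic graph. -/
def IsFVS {V : Type*} (G : SimpleGraph V) (F : Set V) : Prop :=
  (G.induce (Fᶜ : Set V)).IsAcyclic

/-- `fV1 G V1` is the minimum size of a feedback vertex set of `G` contained in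
`V1` (a minimum `V1`-FVS). -/
noncomputable def fV1 {V : Type*} (G : SimpleGraph V) (V1 : Set V) : ℕ :=
  sInf {k | ∃ F : Set V, F ⊆ V1 ∧ IsFVS G F ∧ F.ncard = k}

/-- A `T_{G[V2]}`-tree: a spanning tree of `G` containing every edge of the
induced subgraph `G[V2]`. -/
def IsV2SpanningTree {V : Type*} (G T : SimpleGraph V) (V2 : Set V) : Prop :=
  T ≤ G ∧ T.IsTree ∧ ∀ u v : V, u ∈ V2 → v ∈ V2 → G.Adj u v → T.Adj u v

/-- The `V1`-adjacency matching number `μ(G)`: the maximum, over all spanning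
trees `T` of `G` containing all edges of `G[V2]`, of the number of 2-groups in a
`V1`-adjacency matching of the edges of `G` not in `T`, where a 2-group is a
pair of distinct edges sharing a common endpoint in `V1`. -/
noncomputable def adjMatchNum {V : Type*} (G : SimpleGraph V) (V1 V2 : Set V) : ℕ :=
  sSup {h | ∃ T : SimpleGraph V, IsV2SpanningTree G T V2 ∧
    ∃ e₁ e₂ : Fin h → Sym2 V,
      Function.Injective (Sum.elim e₁ e₂) ∧
      (∀ i, e₁ i ∈ G.edgeSet \ T.edgeSet ∧ e₂ i ∈ G.edgeSet \ T.edgeSet) ∧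
      (∀ i, ∃ x ∈ V1, x ∈ e₁ i ∧ x ∈ e₂ i)}

open SimpleGraph in
theorem spanningCoe_acyclic_aux {V : Type*} (s : Set V) (K : SimpleGraph s)
    (hK : K.IsAcyclic) : K.spanningCoe.IsAcyclic := by
  have hadj : ∀ {a b : V}, K.spanningCoe.Adj a b → a ∈ s ∧ b ∈ s := by
    intro a b h
    rw [SimpleGraph.map_adj] at h
    obtain ⟨x, y, -, rfl, rfl⟩ := h
    exact ⟨x.2, y.2⟩
  have hsupp : ∀ {a b : V} (w : K.spanningCoe.Walk a b), a ∈ s → ∀ x ∈ w.support, x ∈ s := by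
    intro a b w
    induction w with
    | nil => intro ha x hx; simp at hx; exact hx ▸ ha
    | cons h p ih =>
      intro ha x hx
      rw [Walk.support_cons, List.mem_cons] at hx
      rcases hx with rfl | hx
      · exact ha
      · exact ih (hadj h).2 x hx
  intro v w hw
  have hv : v ∈ s := by
    cases w with
    | nil => exact absurd hw Walk.not_isCycle_nil
    | cons h p => exact (hadj h).1
  have hs := hsupp w hv
  have hK' : (K.spanningCoe.induce s).IsAcyclic := by
    rw [SimpleGraph.induce_spanningCoe]; exact hK
  refine hK' (w.induce s hs) ?_
  have hinj : Function.Injective (Embedding.induce (G := K.spanningCoe) s).toHom :=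
    (Embedding.induce (G := K.spanningCoe) s).injective
  rw [← Walk.isCycle_map_iff_of_injective hinj, Walk.map_induce]
  exact hw

theorem card_nontree_aux {V : Type*} [Fintype V] (G T : SimpleGraph V) (hle : T ≤ G)
    (hT : T.IsTree) :
    (G.edgeSet \ T.edgeSet).ncard + Fintype.card V = G.edgeSet.ncard + 1 := by
  classical
  have h1 := hT.card_edgeFinset
  have h2 : T.edgeSet.ncard = T.edgeFinset.card := by
    rw [← SimpleGraph.coe_edgeFinset, Set.ncard_coe_finset]
  have h3 := Set.ncard_sdiff_add_ncard_of_subset (SimpleGraph.edgeSet_mono hle) (Set.toFinite _)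
  omega

/-- From a `V1`-FVS to a matching. -/
theorem lower_aux {V : Type*} [Fintype V] [DecidableEq V]
    (G : SimpleGraph V) [DecidableRel G.Adj] (hconn : G.Connected)
    (V1 V2 : Set V) (hdisj : Disjoint V1 V2)
    (hdeg : ∀ v ∈ V1, G.degree v = 3) (F : Set V) (hF : F ⊆ V1) (hfvs : IsFVS G F) :
    ∃ h, (∃ T : SimpleGraph V, IsV2SpanningTree G T V2 ∧
    ∃ e₁ e₂ : Fin h → Sym2 V,
      Function.Injective (Sum.elim e₁ e₂) ∧
      (∀ i, e₁ i ∈ G.edgeSet \ T.edgeSet ∧ e₂ i ∈ G.edgeSet \ T.edgeSet) ∧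
      (∀ i, ∃ x ∈ V1, x ∈ e₁ i ∧ x ∈ e₂ i)) ∧
      G.edgeSet.ncard + 1 ≤ Fintype.card V + F.ncard + h := by
  classical
  obtain ⟨T, hHT, hTG, hT⟩ := hconn.exists_isTree_le_of_le_of_isAcyclic
    (SimpleGraph.spanningCoe_induce_le G Fᶜ) (spanningCoe_acyclic_aux Fᶜ _ hfvs)
  have hadj : ∀ u v, u ∉ F → v ∉ F → G.Adj u v → T.Adj u v := by
    intro u v hu hv h
    apply hHT
    rw [SimpleGraph.map_adj]
    exact ⟨⟨u, hu⟩, ⟨v, hv⟩, h, rfl, rfl⟩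
  have hcard := card_nontree_aux G T hTG hT
  obtain ⟨D, hD⟩ : ∃ D : Finset (Sym2 V), (D : Set (Sym2 V)) = G.edgeSet \ T.edgeSet :=
    ⟨(Set.toFinite (G.edgeSet \ T.edgeSet)).toFinset, by simp⟩
  have hDm : ∀ e, e ∈ D ↔ e ∈ G.edgeSet \ T.edgeSet := fun e => by rw [← hD]; simp
  rw [← hD, Set.ncard_coe_finset] at hcard
  have hc : ∀ e : Sym2 V, ∃ x, e ∈ D → x ∈ F ∧ x ∈ e := by
    intro e
    by_cases he : e ∈ D
    · rw [hDm] at he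
      induction e with | _ u v =>
      by_cases hu : u ∈ F
      · exact ⟨u, fun _ => ⟨hu, by simp⟩⟩
      by_cases hv : v ∈ F
      · exact ⟨v, fun _ => ⟨hv, by simp⟩⟩
      exact absurd (hadj u v hu hv he.1) he.2
    · obtain ⟨x⟩ := hconn.nonempty
      exact ⟨x, fun h => absurd h he⟩
  choose c hc using hc
  have hfib : ∀ x ∈ F, (D.filter (fun e => c e = x)).card ≤ 2 := by
    intro x hx
    have h3 := hdeg x (hF hx)
    have hsome : ∃ y, T.Adj x y := by
      have hpos : 0 < G.degree x := by omega
      rw [SimpleGraph.degree_pos_iff_exists_adj] at hpos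
      obtain ⟨z, hz⟩ := hpos
      haveI : Nontrivial V := ⟨x, z, hz.ne⟩
      exact hT.1.preconnected.exists_adj_of_nontrivial x
    obtain ⟨y, hy⟩ := hsome
    have hsub : D.filter (fun e => c e = x) ⊆ (G.incidenceFinset x).erase s(x, y) := by
      intro e he
      rw [Finset.mem_filter] at he
      obtain ⟨he, rfl⟩ := he
      have h1 := (hDm e).1 he
      rw [Finset.mem_erase, SimpleGraph.mem_incidenceFinset]
      refine ⟨?_, h1.1, (hc e he).2⟩
      intro h
      apply h1.2
      rw [h]
      exact hy
    have := Finset.card_le_card hsub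
    rw [Finset.card_erase_of_mem (by
      rw [SimpleGraph.mem_incidenceFinset]; exact ⟨hTG hy, by simp⟩),
      SimpleGraph.card_incidenceFinset_eq_degree, h3] at this
    exact this
  obtain ⟨F', hF'⟩ : ∃ F' : Finset V, (F' : Set V) = F := ⟨(Set.toFinite F).toFinset, by simp⟩
  have hFm : ∀ e, e ∈ F' ↔ e ∈ F := fun e => by rw [← hF']; simp
  have hFc : F.ncard = F'.card := by rw [← hF', Set.ncard_coe_finset]
  set S := F'.filter (fun x => (D.filter (fun e => c e = x)).card = 2) with hS
  have hsum : D.card ≤ F'.card + S.card := by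
    rw [Finset.card_eq_sum_card_fiberwise (f := c) (t := F')
      (fun e he => (hFm _).2 (hc e he).1)]
    rw [hS, Finset.card_filter, Finset.card_eq_sum_ones F', ← Finset.sum_add_distrib]
    apply Finset.sum_le_sum
    intro x hx
    have := hfib x ((hFm x).1 hx)
    split_ifs <;> omega
  refine ⟨S.card, ⟨T, ⟨hTG, hT, ?_⟩, ?_⟩, by omega⟩
  · intro u v hu hv h
    exact hadj u v (fun h' => hdisj.le_bot ⟨hF h', hu⟩) (fun h' => hdisj.le_bot ⟨hF h', hv⟩) h
  · have hx : ∀ i : Fin S.card, ∃ a b : Sym2 V, a ≠ b ∧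
        D.filter (fun e => c e = (S.equivFin.symm i : V)) = {a, b} := by
      intro i
      have := (S.equivFin.symm i).2
      exact Finset.card_eq_two.1 (Finset.mem_filter.1 this).2
    choose e₁ e₂ hne heq using hx
    have m1 : ∀ i, e₁ i ∈ D ∧ c (e₁ i) = (S.equivFin.symm i : V) := by
      intro i
      have : e₁ i ∈ D.filter (fun e => c e = (S.equivFin.symm i : V)) := by rw [heq]; simp
      simpa using this
    have m2 : ∀ i, e₂ i ∈ D ∧ c (e₂ i) = (S.equivFin.symm i : V) := by
      intro i
      have : e₂ i ∈ D.filter (fun e => c e = (S.equivFin.symm i : V)) := by rw [heq]; simp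
      simpa using this
    have key : ∀ i j : Fin S.card, (S.equivFin.symm i : V) = S.equivFin.symm j → i = j :=
      fun i j h => S.equivFin.symm.injective (Subtype.ext h)
    refine ⟨e₁, e₂, ?_, fun i => ⟨(hDm _).1 (m1 i).1, (hDm _).1 (m2 i).1⟩, ?_⟩
    · apply Function.Injective.sumElim
      · intro i j h
        exact key i j (by rw [← (m1 i).2, ← (m1 j).2, h])
      · intro i j h
        exact key i j (by rw [← (m2 i).2, ← (m2 j).2, h])
      · intro i j h
        have := key i j (by rw [← (m1 i).2, ← (m2 j).2, h])
        subst this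
        exact hne i h
    · intro i
      refine ⟨c (e₁ i), hF (hc _ (m1 i).1).1, (hc _ (m1 i).1).2, ?_⟩
      rw [(m1 i).2, ← (m2 i).2]
      exact (hc _ (m2 i).1).2

/-- From a matching to a `V1`-FVS. -/
theorem upper_aux {V : Type*} [Fintype V]
    (G : SimpleGraph V) (V1 V2 : Set V)
    (hpart : V1 ∪ V2 = Set.univ) (h : ℕ) (T : SimpleGraph V) (hT : IsV2SpanningTree G T V2)
    (e₁ e₂ : Fin h → Sym2 V)
    (hinj : Function.Injective (Sum.elim e₁ e₂))
    (hmem : ∀ i, e₁ i ∈ G.edgeSet \ T.edgeSet ∧ e₂ i ∈ G.edgeSet \ T.edgeSet)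
    (hx : ∀ i, ∃ x ∈ V1, x ∈ e₁ i ∧ x ∈ e₂ i) :
    ∃ F : Set V, F ⊆ V1 ∧ IsFVS G F ∧
      F.ncard + h + Fintype.card V ≤ G.edgeSet.ncard + 1 := by
  classical
  obtain ⟨hTG, hTt, hT2⟩ := hT
  have hcard := card_nontree_aux G T hTG hTt
  set D := G.edgeSet \ T.edgeSet with hD
  have hc : ∀ e : Sym2 V, ∃ x, e ∈ D → x ∈ V1 ∧ x ∈ e := by
    intro e
    by_cases he : e ∈ D
    · induction e with | _ u v =>
      have hm : ∀ x, x ∉ V1 → x ∈ V2 := fun x hx => by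
        have : x ∈ V1 ∪ V2 := hpart ▸ Set.mem_univ x
        exact this.resolve_left hx
      by_cases hu : u ∈ V1
      · exact ⟨u, fun _ => ⟨hu, by simp⟩⟩
      by_cases hv : v ∈ V1
      · exact ⟨v, fun _ => ⟨hv, by simp⟩⟩
      exact absurd (hT2 u v (hm u hu) (hm v hv) he.1) he.2
    · obtain ⟨x⟩ := hTt.1.nonempty
      exact ⟨x, fun h => absurd h he⟩
  choose c hc using hc
  choose x hx1 hx2 hx3 using hx
  set P := Set.range (Sum.elim e₁ e₂) with hP
  have hPD : P ⊆ D := by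
    rintro _ ⟨i | i, rfl⟩
    · exact (hmem i).1
    · exact (hmem i).2
  have hPc : P.ncard = h + h := by
    rw [hP, ← Set.image_univ, Set.ncard_image_of_injective _ hinj, Set.ncard_univ]
    simp
  have hRc : (D \ P).ncard + P.ncard = D.ncard :=
    Set.ncard_sdiff_add_ncard_of_subset hPD (Set.toFinite _)
  refine ⟨Set.range x ∪ c '' (D \ P), ?_, ?_, ?_⟩
  · rintro y (⟨i, rfl⟩ | ⟨e, he, rfl⟩)
    · exact hx1 i
    · exact (hc e he.1).1
  · have hcov : ∀ e ∈ D, ∃ y ∈ Set.range x ∪ c '' (D \ P), y ∈ e := by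
      intro e he
      by_cases hp : e ∈ P
      · obtain ⟨i | i, rfl⟩ := hp
        · exact ⟨x i, Or.inl ⟨i, rfl⟩, hx2 i⟩
        · exact ⟨x i, Or.inl ⟨i, rfl⟩, hx3 i⟩
      · exact ⟨c e, Or.inr ⟨e, ⟨he, hp⟩, rfl⟩, (hc e he).2⟩
    refine SimpleGraph.IsAcyclic.anti ?_ (hTt.2.induce _)
    intro u v huv
    by_contra hn
    obtain ⟨y, hy, hye⟩ := hcov s((u : V), (v : V)) ⟨huv, hn⟩
    rw [Sym2.mem_iff] at hye
    rcases hye with rfl | rfl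
    · exact u.2 hy
    · exact v.2 hy
  · have h1 := Set.ncard_union_le (Set.range x) (c '' (D \ P))
    have h2 : (c '' (D \ P)).ncard ≤ (D \ P).ncard := Set.ncard_image_le (Set.toFinite _)
    have h3 : (Set.range x).ncard ≤ h := by
      rw [← Set.image_univ]
      refine (Set.ncard_image_le (Set.toFinite _)).trans ?_
      rw [Set.ncard_univ]; simp
    omega

/-- For a connected graph `G` with partition `(V1, V2)` into two forests where
every vertex of `V1` has degree exactly 3:
`f_{V1}(G) = β(G) − μ(G)`, where `β(G) = |E(G)| − |V(G)| + 1`. -/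
theorem stmt_10 {V : Type*} [Fintype V] [DecidableEq V]
    (G : SimpleGraph V) [DecidableRel G.Adj] (hconn : G.Connected)
    (V1 V2 : Set V)
    (hpart : V1 ∪ V2 = Set.univ) (hdisj : Disjoint V1 V2)
    (hforest1 : (G.induce V1).IsAcyclic) (hforest2 : (G.induce V2).IsAcyclic)
    (hdeg : ∀ v ∈ V1, G.degree v = 3) :
    (fV1 G V1 : ℤ) =
      ((G.edgeSet.ncard : ℤ) - (Fintype.card V : ℤ) + 1) - (adjMatchNum G V1 V2 : ℤ) := by
  set A := {h | ∃ T : SimpleGraph V, IsV2SpanningTree G T V2 ∧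
    ∃ e₁ e₂ : Fin h → Sym2 V,
      Function.Injective (Sum.elim e₁ e₂) ∧
      (∀ i, e₁ i ∈ G.edgeSet \ T.edgeSet ∧ e₂ i ∈ G.edgeSet \ T.edgeSet) ∧
      (∀ i, ∃ x ∈ V1, x ∈ e₁ i ∧ x ∈ e₂ i)} with hA
  set B := {k | ∃ F : Set V, F ⊆ V1 ∧ IsFVS G F ∧ F.ncard = k} with hB
  have hV1 : IsFVS G V1 := by
    have : V1ᶜ = V2 := (IsCompl.mk hdisj (codisjoint_iff.2 hpart)).compl_eq
    unfold IsFVS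
    rw [this]
    exact hforest2
  have hlow : ∀ k ∈ B, ∃ h ∈ A, G.edgeSet.ncard + 1 ≤ Fintype.card V + k + h := by
    rintro k ⟨F, hF, hfvs, rfl⟩
    exact lower_aux G hconn V1 V2 hdisj hdeg F hF hfvs
  have hup : ∀ h ∈ A, ∃ k ∈ B, k + h + Fintype.card V ≤ G.edgeSet.ncard + 1 := by
    rintro h ⟨T, hT, e₁, e₂, h1, h2, h3⟩
    obtain ⟨F, hF, hfvs, hle⟩ := upper_aux G V1 V2 hpart h T hT e₁ e₂ h1 h2 h3
    exact ⟨_, ⟨F, hF, hfvs, rfl⟩, hle⟩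
  have hBne : B.Nonempty := ⟨_, V1, subset_rfl, hV1, rfl⟩
  have hAne : A.Nonempty := by
    obtain ⟨k, hk⟩ := hBne
    obtain ⟨h, hh, -⟩ := hlow k hk
    exact ⟨h, hh⟩
  have hAb : BddAbove A := by
    refine ⟨G.edgeSet.ncard + 1, ?_⟩
    intro h hh
    obtain ⟨k, -, hk⟩ := hup h hh
    omega
  have hf : fV1 G V1 = sInf B := rfl
  have hm : adjMatchNum G V1 V2 = sSup A := rfl
  obtain ⟨h, hh, hle1⟩ := hlow _ (Nat.sInf_mem hBne)
  obtain ⟨k, hk, hle2⟩ := hup _ (Nat.sSup_mem hAne hAb)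
  have h4 := le_csSup hAb hh
  have h5 := Nat.sInf_le hk
  rw [hf, hm]
  omega
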